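/- arXiv:2605.28586 — 2 statements merged into one kernel-verified Lean document; each statement's English description precedes it below -/
import Mathlib

section
/- Define four three-qutrit vectors: σ₁(y) = 3^{−3/2}·ω^{2y₀² + 2y₁² + y₂²} and σ₂(y) = 3^{−3/2}·ω^{y₀² + y₁² + 2y₂²} for all y ∈ 𝔽₃³ (exponents mod 3), σ₃ = |0⟩⊗|0⟩⊗|+⟩, and σ₄ = |+⟩⊗|+⟩⊗|0⟩, where |+⟩ = (|0⟩+|1⟩+|2⟩)/√3. With α₁ = (3c/4N)(1+i), α₂ = (3c/4N)(1−i), α₃ = α₄ = 3/(4N), one has |H₃⟩^{⊗3} = α₁σ₁ + α₂σ₂ + α₃σ₃ + α₄σ₄. All four σⱼ are canonical 3-qutrit stabilizer states, so χ(|H₃⟩^{⊗3}) ≤ 4. -/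
open Complex
open scoped BigOperators

noncomputable section

/-- An `m`-qutrit state is a vector of amplitudes indexed by `Fin m → ZMod 3`. -/
abbrev QS (m : ℕ) := (Fin m → ZMod 3) → ℂ

/-- The primitive cube root of unity `ω = exp(2πi/3)`. -/
def ω : ℂ := Complex.exp (2 * Real.pi * Complex.I / 3)

/-- `ω` raised to an exponent in `ZMod 3`. -/
def ωp (a : ZMod 3) : ℂ := ω ^ a.val

/-- A polynomial `Q : 𝔽₃^k → 𝔽₃` of degree at most 2. -/
def IsDeg2 {k : ℕ} (Q : (Fin k → ZMod 3) → ZMod 3) : Prop :=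
  ∃ (A : Fin k → Fin k → ZMod 3) (b : Fin k → ZMod 3) (c : ZMod 3),
    ∀ y, Q y = (∑ i, ∑ j, A i j * y i * y j) + (∑ i, b i * y i) + c

/-- `σ` is a canonical `m`-qutrit stabilizer state:
`σ = 3^{-k/2} ∑_{y ∈ 𝔽₃^k} ω^{Q(y)} |x₀ + W y⟩` with `W` injective linear and `deg Q ≤ 2`. -/
def IsStab {m : ℕ} (σ : QS m) : Prop :=
  ∃ k : ℕ, k ≤ m ∧
    ∃ (x₀ : Fin m → ZMod 3)
      (W : (Fin k → ZMod 3) →ₗ[ZMod 3] (Fin m → ZMod 3))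
      (Q : (Fin k → ZMod 3) → ZMod 3),
      Function.Injective W ∧ IsDeg2 Q ∧
      σ = fun x => ((Real.sqrt (3 ^ k) : ℝ) : ℂ)⁻¹ *
        ∑ y : Fin k → ZMod 3, if x = x₀ + W y then ωp (Q y) else 0

/-- The stabilizer rank: the least `r` such that `ψ` is a ℂ-linear combination of `r`
canonical stabilizer states. -/
def stabRank {m : ℕ} (ψ : QS m) : ℕ :=
  sInf {r : ℕ | ∃ (c : Fin r → ℂ) (σ : Fin r → QS m),
    (∀ i, IsStab (σ i)) ∧ ψ = ∑ i, c i • σ i}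

/-- The `m`-fold tensor power of a single-qutrit state. -/
def tpow (ψ : ZMod 3 → ℂ) (m : ℕ) : QS m := fun x => ∏ i, ψ (x i)

/-- `c = (√3 - 1)/2`. -/
def cst : ℝ := (Real.sqrt 3 - 1) / 2

/-- `N = √(3 - √3)`. -/
def Nst : ℝ := Real.sqrt (3 - Real.sqrt 3)

/-- The Hadamard-eigenstate `|H₃⟩ = (1/N)(|0⟩ + c|1⟩ + c|2⟩)`. -/
def H3 : ZMod 3 → ℂ := fun j =>
  ((Nst : ℝ) : ℂ)⁻¹ * ((if j = 0 then 1 else 0) + (cst : ℂ) * (if j = 1 then 1 else 0)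
    + (cst : ℂ) * (if j = 2 then 1 else 0))

/-- `σ₁(y) = 3^{-3/2}·ω^{2y₀² + 2y₁² + y₂²}`. -/
def σG1 : QS 3 := fun y =>
  ((Real.sqrt (3 ^ 3) : ℝ) : ℂ)⁻¹ * ωp (2 * y 0 ^ 2 + 2 * y 1 ^ 2 + y 2 ^ 2)

/-- `σ₂(y) = 3^{-3/2}·ω^{y₀² + y₁² + 2y₂²}`. -/
def σG2 : QS 3 := fun y =>
  ((Real.sqrt (3 ^ 3) : ℝ) : ℂ)⁻¹ * ωp (y 0 ^ 2 + y 1 ^ 2 + 2 * y 2 ^ 2)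

/-- `σ₃ = |0⟩ ⊗ |0⟩ ⊗ |+⟩`. -/
def σG3 : QS 3 := fun y =>
  (if y 0 = 0 then 1 else 0) * (if y 1 = 0 then 1 else 0) * ((Real.sqrt 3 : ℝ) : ℂ)⁻¹

/-- `σ₄ = |+⟩ ⊗ |+⟩ ⊗ |0⟩`. -/
def σG4 : QS 3 := fun y => (1 / 3 : ℂ) * (if y 2 = 0 then 1 else 0)

theorem cast_sqrt_three_sq : ((Real.sqrt 3 : ℝ) : ℂ) ^ 2 = 3 := by
  rw [← Complex.ofReal_pow, Real.sq_sqrt (by norm_num)]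
  norm_num

theorem cast_sqrt_three_inv : ((Real.sqrt 3 : ℝ) : ℂ)⁻¹ = ((Real.sqrt 3 : ℝ) : ℂ) / 3 := by
  have h := cast_sqrt_three_sq
  have h0 : ((Real.sqrt 3 : ℝ) : ℂ) ≠ 0 := by
    intro h0
    norm_num [h0] at h
  field_simp
  exact h.symm

theorem cast_sqrt_three_cubed_inv :
    ((Real.sqrt (3 ^ 3) : ℝ) : ℂ)⁻¹ = ((Real.sqrt 3 : ℝ) : ℂ) / 9 := by
  have h : Real.sqrt (3 ^ 3) = 3 * Real.sqrt 3 := by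
    rw [show (3 : ℝ) ^ 3 = 3 ^ 2 * 3 by norm_num, Real.sqrt_mul (by norm_num),
      Real.sqrt_sq (by norm_num)]
  rw [h, Complex.ofReal_mul, mul_inv, cast_sqrt_three_inv]
  push_cast
  ring

theorem ω_eq : ω = -1 / 2 + ((Real.sqrt 3 : ℝ) : ℂ) / 2 * Complex.I := by
  have h : (2 * Real.pi * Complex.I / 3 : ℂ) =
      ((Real.pi - Real.pi / 3 : ℝ) : ℂ) * Complex.I := by
    push_cast
    ring
  rw [ω, h, Complex.exp_mul_I, ← Complex.ofReal_cos, ← Complex.ofReal_sin, Real.cos_pi_sub,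
    Real.sin_pi_sub, Real.cos_pi_div_three, Real.sin_pi_div_three]
  push_cast
  ring

theorem cast_Nst_inv_cubed : ((Nst : ℝ) : ℂ)⁻¹ ^ 3 =
    ((Nst : ℝ) : ℂ)⁻¹ * (3 + ((Real.sqrt 3 : ℝ) : ℂ)) / 6 := by
  have hlt : Real.sqrt 3 < 3 := by
    rw [Real.sqrt_lt' (by norm_num)]
    norm_num
  have hN : ((Nst : ℝ) : ℂ) ≠ 0 :=
    Complex.ofReal_ne_zero.mpr (Real.sqrt_ne_zero'.mpr (by linarith))
  have hsq : ((Nst : ℝ) : ℂ) ^ 2 = 3 - ((Real.sqrt 3 : ℝ) : ℂ) := by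
    rw [← Complex.ofReal_pow, Nst, Real.sq_sqrt (by linarith)]
    norm_num
  field_simp
  rw [hsq]
  linear_combination cast_sqrt_three_sq

theorem tpow_H3_three :
    tpow H3 3 =
      ((((3 * cst) / (4 * Nst) : ℝ) : ℂ) * (1 + Complex.I)) • σG1 +
      ((((3 * cst) / (4 * Nst) : ℝ) : ℂ) * (1 - Complex.I)) • σG2 +
      (((3 / (4 * Nst) : ℝ) : ℂ)) • σG3 +
      (((3 / (4 * Nst) : ℝ) : ℂ)) • σG4 := by
  funext x
  have hs := cast_sqrt_three_sq
  have hN := cast_Nst_inv_cubed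
  have hI := Complex.I_sq
  simp only [tpow, H3, Fin.prod_univ_three, Pi.add_apply, Pi.smul_apply, smul_eq_mul, σG1, σG2,
    σG3, σG4, ωp, cast_sqrt_three_inv, cast_sqrt_three_cubed_inv, ω_eq, cst]
  push_cast
  simp only [div_eq_mul_inv, mul_inv] at hN ⊢
  generalize ((Nst : ℝ) : ℂ)⁻¹ = n at hN ⊢
  generalize ((Real.sqrt 3 : ℝ) : ℂ) = s at hs hN ⊢
  generalize x 0 = a, x 1 = b, x 2 = c
  have hcases : ∀ t : ZMod 3, t = 0 ∨ t = 1 ∨ t = 2 := by decide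
  rcases hcases a with rfl | rfl | rfl <;> rcases hcases b with rfl | rfl | rfl <;>
    rcases hcases c with rfl | rfl | rfl <;> clear hcases <;>
    simp [show (1 : ZMod 3) ≠ 0 by decide, show (2 : ZMod 3) ≠ 0 by decide,
      show (2 : ZMod 3) ≠ 1 by decide, show (0 : ZMod 3) ≠ 2 by decide,
      show (1 : ZMod 3) ≠ 2 by decide,
      show (2 : ZMod 3) ^ 2 = 1 by decide, show (2 : ZMod 3) + 1 = 0 by decide,
      show (1 : ZMod 3) + 2 = 0 by decide, show (2 : ZMod 3) + 2 = 1 by decide,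
      show (1 : ZMod 3) + 1 = 2 by decide, show ZMod.val (1 : ZMod 3) = 1 by decide,
      show ZMod.val (2 : ZMod 3) = 2 by decide] <;>
    grind

/-- A phase state with quadratic exponent and full support is a stabilizer state. -/
theorem isStab_of_isDeg2 {m : ℕ} {Q : (Fin m → ZMod 3) → ZMod 3} (hQ : IsDeg2 Q) :
    IsStab fun x => ((Real.sqrt (3 ^ m) : ℝ) : ℂ)⁻¹ * ωp (Q x) := by
  refine ⟨m, le_rfl, 0, LinearMap.id, Q, Function.injective_id, hQ, ?_⟩
  simp

theorem isDeg2_diagonal (d : Fin 3 → ZMod 3) :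
    IsDeg2 fun y : Fin 3 → ZMod 3 => d 0 * y 0 ^ 2 + d 1 * y 1 ^ 2 + d 2 * y 2 ^ 2 := by
  refine ⟨Matrix.diagonal d, 0, 0, fun y => ?_⟩
  simp [Fin.sum_univ_three, Matrix.diagonal_apply]
  ring

theorem isDeg2_zero {k : ℕ} : IsDeg2 (0 : (Fin k → ZMod 3) → ZMod 3) :=
  ⟨0, 0, 0, fun y => by simp⟩

theorem isStab_σG1 : IsStab σG1 := by
  unfold σG1
  simpa using isStab_of_isDeg2 (isDeg2_diagonal ![2, 2, 1])

theorem isStab_σG2 : IsStab σG2 := by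
  unfold σG2
  simpa using isStab_of_isDeg2 (isDeg2_diagonal ![1, 1, 2])

/-- The uniform superposition over the range of an injective linear map is a stabilizer state. -/
theorem isStab_uniform {k m : ℕ} (hk : k ≤ m)
    (W : (Fin k → ZMod 3) →ₗ[ZMod 3] (Fin m → ZMod 3)) (hW : Function.Injective W)
    (p : (Fin m → ZMod 3) → Prop) [DecidablePred p] (hp : ∀ x, p x ↔ ∃ y, W y = x) :
    IsStab fun x => ((Real.sqrt (3 ^ k) : ℝ) : ℂ)⁻¹ * (if p x then 1 else 0) := by
  refine ⟨k, hk, 0, W, 0, hW, isDeg2_zero, ?_⟩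
  funext x
  congr 1
  split_ifs with h
  · obtain ⟨y, rfl⟩ := (hp x).mp h
    simp [hW.eq_iff, ωp]
  · rw [Finset.sum_eq_zero]
    intro y _
    rw [if_neg]
    rw [zero_add]
    rintro rfl
    exact h ((hp _).mpr ⟨y, rfl⟩)

theorem isStab_σG3 : IsStab σG3 := by
  convert isStab_uniform (k := 1) (m := 3) (by norm_num)
    (LinearMap.pi ![0, 0, LinearMap.proj 0]) (fun y z h => ?_)
    (fun x => x 0 = 0 ∧ x 1 = 0) (fun x => ⟨fun h => ⟨![x 2], ?_⟩, ?_⟩) using 2 with x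
  · rw [ite_and]
    split_ifs <;> simp [σG3, *]
  · ext i
    have := congrFun h 2
    fin_cases i
    simpa using this
  · ext i
    fin_cases i <;> simp [h.1, h.2]
  · rintro ⟨y, rfl⟩
    simp

theorem isStab_σG4 : IsStab σG4 := by
  convert isStab_uniform (k := 2) (m := 3) (by norm_num)
    (LinearMap.pi ![LinearMap.proj 0, LinearMap.proj 1, 0]) (fun y z h => ?_)
    (fun x => x 2 = 0) (fun x => ⟨fun h => ⟨![x 0, x 1], ?_⟩, ?_⟩) using 2 with x
  · norm_num [σG4]
  · have h0 := congrFun h 0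
    have h1 := congrFun h 1
    ext i
    fin_cases i
    · simpa using h0
    · simpa using h1
  · ext i
    fin_cases i <;> simp [h]
  · rintro ⟨y, rfl⟩
    simp

theorem stabRank_le {m r : ℕ} {ψ : QS m} (c : Fin r → ℂ) (σ : Fin r → QS m)
    (hσ : ∀ i, IsStab (σ i)) (hψ : ψ = ∑ i, c i • σ i) : stabRank ψ ≤ r :=
  Nat.sInf_le ⟨c, σ, hσ, hψ⟩

/-- with `α₁ = (3c/4N)(1+i)`, `α₂ = (3c/4N)(1-i)`, `α₃ = α₄ = 3/(4N)`,
`|H₃⟩^{⊗3} = α₁σ₁ + α₂σ₂ + α₃σ₃ + α₄σ₄`; all four are canonical 3-qutrit stabilizer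
states, so `χ(|H₃⟩^{⊗3}) ≤ 4`. -/
theorem h3_m3_decomposition :
    tpow H3 3 =
      ((((3 * cst) / (4 * Nst) : ℝ) : ℂ) * (1 + Complex.I)) • σG1 +
      ((((3 * cst) / (4 * Nst) : ℝ) : ℂ) * (1 - Complex.I)) • σG2 +
      (((3 / (4 * Nst) : ℝ) : ℂ)) • σG3 +
      (((3 / (4 * Nst) : ℝ) : ℂ)) • σG4 ∧
    IsStab σG1 ∧ IsStab σG2 ∧ IsStab σG3 ∧ IsStab σG4 ∧
    stabRank (tpow H3 3) ≤ 4 := by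
  refine ⟨tpow_H3_three, isStab_σG1, isStab_σG2, isStab_σG3, isStab_σG4, ?_⟩
  refine stabRank_le
    ![(((3 * cst) / (4 * Nst) : ℝ) : ℂ) * (1 + Complex.I),
      (((3 * cst) / (4 * Nst) : ℝ) : ℂ) * (1 - Complex.I),
      ((3 / (4 * Nst) : ℝ) : ℂ), ((3 / (4 * Nst) : ℝ) : ℂ)]
    ![σG1, σG2, σG3, σG4] (fun i => ?_) ?_
  · fin_cases i
    exacts [isStab_σG1, isStab_σG2, isStab_σG3, isStab_σG4]
  · rw [Fin.sum_univ_four]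
    exact tpow_H3_three
end
end

section
/- For every k ≥ 1 and for each M ∈ {|H₃⟩, |ℕ⟩}, χ(M^{⊗3k}) ≤ 4^k. In particular the per-copy asymptotic stabilizer-rank exponents satisfy γ_{H₃} ≤ log₃(4)/3 and γ_ℕ ≤ log₃(4)/3: for every k, log₃ χ(M^{⊗3k})/(3k) ≤ log₃(4)/3. -/
open Complex
open scoped BigOperators

noncomputable section

/-- The Norrell state `|ℕ⟩ = (|0⟩ + |1⟩ - 2|2⟩)/√6`. -/
def Nor : ZMod 3 → ℂ := fun j =>
  ((if j = 0 then 1 else 0) + (if j = 1 then 1 else 0) - 2 * (if j = 2 then 1 else 0))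
    / (Real.sqrt 6 : ℂ)

/-- The tensor product of two multi-qutrit states. -/
def tensorState {m n : ℕ} (ψ : QS m) (φ : QS n) : QS (m + n) :=
  fun x => ψ (fun i => x (Fin.castAdd n i)) * φ (fun i => x (Fin.natAdd m i))

/-- `ψ` is a linear combination of `r` canonical stabilizer states. -/
def HasStabDecomp {m : ℕ} (r : ℕ) (ψ : QS m) : Prop :=
  ∃ (c : Fin r → ℂ) (σ : Fin r → QS m), (∀ i, IsStab (σ i)) ∧ ψ = ∑ i, c i • σ i

theorem omega_pow_three : ω ^ 3 = 1 := by
  rw [ω, ← Complex.exp_nat_mul, ← Complex.exp_two_pi_mul_I]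
  congr 1
  push_cast
  ring

theorem omega_ne_one : ω ≠ 1 := by
  have h : IsPrimitiveRoot ω 3 := by
    simpa [ω] using Complex.isPrimitiveRoot_exp 3 (by norm_num)
  exact h.ne_one (by norm_num)

theorem one_add_omega_add_omega_sq : 1 + ω + ω ^ 2 = 0 := by
  have h : (ω - 1) * (1 + ω + ω ^ 2) = 0 := by linear_combination omega_pow_three
  exact (mul_eq_zero.mp h).resolve_left (sub_ne_zero.mpr omega_ne_one)

theorem omegap_add (a b : ZMod 3) : ωp (a + b) = ωp a * ωp b := by
  rw [ωp, ωp, ωp, ← pow_add, ZMod.val_add]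
  exact (pow_eq_pow_mod _ omega_pow_three).symm

theorem IsDeg2.append {k l : ℕ} {P : (Fin k → ZMod 3) → ZMod 3} {Q : (Fin l → ZMod 3) → ZMod 3}
    (hP : IsDeg2 P) (hQ : IsDeg2 Q) :
    IsDeg2 fun y : Fin (k + l) → ZMod 3 =>
      P (fun i => y (Fin.castAdd l i)) + Q (fun i => y (Fin.natAdd k i)) := by
  obtain ⟨A, b, c, h⟩ := hP
  obtain ⟨A', b', c', h'⟩ := hQ
  refine ⟨fun i => Fin.addCases (fun i => Fin.addCases (A i) fun _ => 0)
    (fun i => Fin.addCases (fun _ => 0) (A' i)) i, Fin.addCases b b', c + c', fun y => ?_⟩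
  simp only [h, h', Fin.sum_univ_add, Fin.addCases_left, Fin.addCases_right, zero_mul,
    Finset.sum_const_zero, add_zero, zero_add]
  ring

theorem IsStab.tensorState {m n : ℕ} {σ : QS m} {τ : QS n} (hσ : IsStab σ) (hτ : IsStab τ) :
    IsStab (tensorState σ τ) := by
  obtain ⟨k, hk, x₀, W, P, hW, hP, rfl⟩ := hσ
  obtain ⟨l, hl, x₁, V, Q, hV, hQ, rfl⟩ := hτ
  let L : (Fin (k + l) → ZMod 3) →ₗ[ZMod 3] (Fin (m + n) → ZMod 3) :=
    { toFun := fun y => Fin.append (W fun i => y (Fin.castAdd l i)) (V fun i => y (Fin.natAdd k i))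
      map_add' := fun y z => by
        ext i
        refine Fin.addCases (fun i => ?_) (fun i => ?_) i
        · simp only [Fin.append_left, Pi.add_apply]
          exact congrFun
            (W.map_add (fun i => y (Fin.castAdd l i)) (fun i => z (Fin.castAdd l i))) i
        · simp only [Fin.append_right, Pi.add_apply]
          exact congrFun
            (V.map_add (fun i => y (Fin.natAdd k i)) (fun i => z (Fin.natAdd k i))) i
      map_smul' := fun a y => by
        ext i
        refine Fin.addCases (fun i => ?_) (fun i => ?_) i
        · simp only [Fin.append_left, Pi.smul_apply, RingHom.id_apply]
          exact congrFun (W.map_smul a (fun i => y (Fin.castAdd l i))) i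
        · simp only [Fin.append_right, Pi.smul_apply, RingHom.id_apply]
          exact congrFun (V.map_smul a (fun i => y (Fin.natAdd k i))) i }
  have hL : ∀ y, L y =
      Fin.append (W fun i => y (Fin.castAdd l i)) (V fun i => y (Fin.natAdd k i)) := fun _ => rfl
  have ext_append {p q : ℕ} (f g : Fin (p + q) → ZMod 3) : f = g ↔
      (fun i => f (Fin.castAdd q i)) = (fun i => g (Fin.castAdd q i)) ∧
      (fun i => f (Fin.natAdd p i)) = (fun i => g (Fin.natAdd p i)) := by
    refine ⟨fun h => by simp [h], fun ⟨h₁, h₂⟩ => ?_⟩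
    ext i
    exact Fin.addCases (fun i => congrFun h₁ i) (fun i => congrFun h₂ i) i
  refine ⟨k + l, by omega, Fin.append x₀ x₁, L, _, fun y z h => ?_, hP.append hQ, ?_⟩
  · rw [hL, hL, ext_append] at h
    simp only [Fin.append_left, Fin.append_right] at h
    exact (ext_append y z).mpr ⟨hW h.1, hV h.2⟩
  · funext x
    rw [← (Fin.appendEquiv k l).sum_comp, Fintype.sum_prod_type]
    have hadd (f g : Fin m → ZMod 3) : (fun i => f i + g i) = f + g := rfl
    have hadd' (f g : Fin n → ZMod 3) : (fun i => f i + g i) = f + g := rfl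
    simp only [_root_.tensorState, ext_append x, hL, Fin.appendEquiv, Equiv.coe_fn_mk,
      Pi.add_apply, Fin.append_left, Fin.append_right, omegap_add, hadd, hadd',
      ite_and, pow_add]
    rw [Real.sqrt_mul (by positivity), Complex.ofReal_mul, mul_inv, mul_mul_mul_comm,
      Finset.sum_mul_sum]
    congr 1
    refine Finset.sum_congr rfl fun y _ => Finset.sum_congr rfl fun z _ => ?_
    split_ifs <;> simp

theorem isStab_single {m : ℕ} (x₀ : Fin m → ZMod 3) :
    IsStab (fun x : Fin m → ZMod 3 => if x = x₀ then (1 : ℂ) else 0) := by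
  refine ⟨0, Nat.zero_le _, x₀, 0, 0, Function.injective_of_subsingleton _,
    ⟨0, 0, 0, by simp⟩, ?_⟩
  funext x
  simp [ωp]

theorem isStab_phase {m : ℕ} {Q : (Fin m → ZMod 3) → ZMod 3} (hQ : IsDeg2 Q) :
    IsStab (fun x => ((Real.sqrt (3 ^ m) : ℝ) : ℂ)⁻¹ * ωp (Q x)) := by
  refine ⟨m, le_rfl, 0, LinearMap.id, Q, Function.injective_id, hQ, ?_⟩
  funext x
  simp

theorem isDeg2_mul_sum_sq_sub {m : ℕ} (t s : ZMod 3) :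
    IsDeg2 fun x : Fin m → ZMod 3 => t * ∑ i, (x i - s) ^ 2 := by
  refine ⟨fun i j => if i = j then t else 0, fun _ => -2 * t * s, ∑ _i : Fin m, t * s ^ 2,
    fun y => ?_⟩
  simp only [ite_mul, zero_mul, Finset.sum_ite_eq, Finset.mem_univ, if_true,
    ← Finset.sum_add_distrib, Finset.mul_sum]
  exact Finset.sum_congr rfl fun i _ => by ring

theorem HasStabDecomp.tensorState {m n r s : ℕ} {ψ : QS m} {φ : QS n}
    (hψ : HasStabDecomp r ψ) (hφ : HasStabDecomp s φ) :
    HasStabDecomp (r * s) (tensorState ψ φ) := by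
  obtain ⟨c, σ, hσ, rfl⟩ := hψ
  obtain ⟨d, τ, hτ, rfl⟩ := hφ
  refine ⟨fun i => c (finProdFinEquiv.symm i).1 * d (finProdFinEquiv.symm i).2,
    fun i => _root_.tensorState (σ (finProdFinEquiv.symm i).1) (τ (finProdFinEquiv.symm i).2),
    fun i => (hσ _).tensorState (hτ _), ?_⟩
  funext x
  rw [finProdFinEquiv.symm.sum_comp
    (fun p : Fin r × Fin s => (c p.1 * d p.2) • _root_.tensorState (σ p.1) (τ p.2)),
    Fintype.sum_prod_type]
  simp only [_root_.tensorState, Finset.sum_apply, Pi.smul_apply, smul_eq_mul, Finset.sum_mul_sum]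
  exact Finset.sum_congr rfl fun i _ => Finset.sum_congr rfl fun j _ => by ring

theorem tpow_add (M : ZMod 3 → ℂ) (m n : ℕ) :
    tpow M (m + n) = tensorState (tpow M m) (tpow M n) := by
  funext x
  simp [tpow, tensorState, Fin.prod_univ_add]

/-- The cube of a state taking only two values, one of them at a single basis vector, is a
combination of three quadratic phases and one basis state. -/
theorem hasStabDecomp_tpow_three (s : ZMod 3) (a b : ℂ) :
    HasStabDecomp 4 (tpow (fun x => if x = s then a else b) 3) := by
  let P : ZMod 3 → QS 3 := fun t x =>
    ((Real.sqrt (3 ^ 3) : ℝ) : ℂ)⁻¹ * ωp (t * ∑ i, (x i - s) ^ 2)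
  have hP (t : ZMod 3) : IsStab (P t) := isStab_phase (isDeg2_mul_sum_sq_sub t s)
  have hS : ((Real.sqrt (3 ^ 3) : ℝ) : ℂ) ≠ 0 :=
    Complex.ofReal_ne_zero.mpr (by positivity)
  refine ⟨![((Real.sqrt (3 ^ 3) : ℝ) : ℂ) * ((b ^ 3 + a ^ 2 * b + a * b ^ 2) / 3),
      ((Real.sqrt (3 ^ 3) : ℝ) : ℂ) * ((b ^ 3 + a ^ 2 * b * ω ^ 2 + a * b ^ 2 * ω) / 3),
      ((Real.sqrt (3 ^ 3) : ℝ) : ℂ) * ((b ^ 3 + a ^ 2 * b * ω + a * b ^ 2 * ω ^ 2) / 3),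
      a ^ 3 - b ^ 3],
    ![P 0, P 1, P 2, fun x => if x = fun _ => s then 1 else 0], ?_, ?_⟩
  · intro i
    fin_cases i
    exacts [hP 0, hP 1, hP 2, isStab_single _]
  · funext x
    have key (z : ZMod 3) : (z = s ∧ (z - s) ^ 2 = 0) ∨ (z ≠ s ∧ (z - s) ^ 2 = 1) := by
      clear hP P; revert z s; decide
    have h1 : ωp 1 = ω := pow_one ω
    have h0 : ωp 0 = 1 := pow_zero ω
    have h2 : ωp 2 = ω ^ 2 := rfl
    have e11 : (1 + 1 : ZMod 3) = 2 := rfl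
    have e12 : (2 + 1 : ZMod 3) = 0 := rfl
    have e22 : (2 * 2 : ZMod 3) = 1 := rfl
    simp only [tpow, Fin.sum_univ_four, Fin.prod_univ_three, Pi.add_apply, Pi.smul_apply,
      smul_eq_mul, P, Matrix.cons_val, Fin.sum_univ_three, funext_iff, Fin.forall_fin_succ,
      IsEmpty.forall_iff, and_true, Fin.succ_zero_eq_one, Fin.succ_one_eq_two]
    have cancel (u v : ℂ) : ((Real.sqrt (3 ^ 3) : ℝ) : ℂ) * u *
        (((Real.sqrt (3 ^ 3) : ℝ) : ℂ)⁻¹ * v) = u * v := by field_simp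
    simp only [cancel]
    rcases key (x 0) with ⟨p0, q0⟩ | ⟨p0, q0⟩ <;> rcases key (x 1) with ⟨p1, q1⟩ | ⟨p1, q1⟩ <;>
      rcases key (x 2) with ⟨p2, q2⟩ | ⟨p2, q2⟩ <;>
      simp only [p0, p1, p2, q0, q1, q2, if_true, if_false, and_true, and_false, add_zero,
        mul_zero, zero_mul, mul_one, one_mul, e11, e12, h0] <;>
      grind [one_add_omega_add_omega_sq]

theorem hasStabDecomp_tpow (s : ZMod 3) (a b : ℂ) (k : ℕ) :
    HasStabDecomp (4 ^ k) (tpow (fun x => if x = s then a else b) (3 * k)) := by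
  induction k with
  | zero =>
    refine ⟨fun _ => 1, fun _ x => if x = 0 then 1 else 0, fun _ => isStab_single _, ?_⟩
    funext x
    have hx : x = 0 := Subsingleton.elim (α := Fin 0 → ZMod 3) x 0
    simp [tpow, hx]
  | succ k ih =>
    rw [Nat.mul_succ, pow_succ, tpow_add]
    exact ih.tensorState (hasStabDecomp_tpow_three s a b)

theorem H3_eq_ite : H3 = fun x => if x = 0 then (Nst : ℂ)⁻¹ else (Nst : ℂ)⁻¹ * cst := by
  funext x
  have h01 : (0 : ZMod 3) ≠ 1 := by decide
  have h02 : (0 : ZMod 3) ≠ 2 := by decide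
  have h12 : (1 : ZMod 3) ≠ 2 := by decide
  have h : x = 0 ∨ x = 1 ∨ x = 2 := by revert x; decide
  rcases h with rfl | rfl | rfl <;> simp [H3, h01, h02, h12, h01.symm, h02.symm, h12.symm]

theorem Nor_eq_ite :
    Nor = fun x => if x = 2 then -2 / (Real.sqrt 6 : ℂ) else 1 / (Real.sqrt 6 : ℂ) := by
  funext x
  have h01 : (0 : ZMod 3) ≠ 1 := by decide
  have h02 : (0 : ZMod 3) ≠ 2 := by decide
  have h12 : (1 : ZMod 3) ≠ 2 := by decide
  have h : x = 0 ∨ x = 1 ∨ x = 2 := by revert x; decide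
  rcases h with rfl | rfl | rfl <;> simp [Nor, h01, h02, h12, h01.symm, h02.symm, h12.symm]

/-- for `M ∈ {|H₃⟩, |ℕ⟩}` and every `k ≥ 1`, `χ(M^{⊗3k}) ≤ 4^k`, hence
`log₃ χ(M^{⊗3k}) / (3k) ≤ log₃(4)/3`. -/
theorem h3_norrell_exponent_bound :
    ∀ M : ZMod 3 → ℂ, (M = H3 ∨ M = Nor) →
      ∀ k : ℕ, 1 ≤ k →
        stabRank (tpow M (3 * k)) ≤ 4 ^ k ∧
        Real.logb 3 (stabRank (tpow M (3 * k)) : ℝ) / (3 * k : ℝ) ≤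
          Real.logb 3 4 / 3 := by
  intro M hM k hk
  have hrank : stabRank (tpow M (3 * k)) ≤ 4 ^ k := by
    obtain ⟨s, a, b, rfl⟩ : ∃ s a b, M = fun x => if x = s then a else b := by
      rcases hM with rfl | rfl
      exacts [⟨_, _, _, H3_eq_ite⟩, ⟨_, _, _, Nor_eq_ite⟩]
    exact Nat.sInf_le (hasStabDecomp_tpow s a b k)
  refine ⟨hrank, ?_⟩
  have hk' : (0 : ℝ) < k := by exact_mod_cast hk
  have hlog : Real.logb 3 (stabRank (tpow M (3 * k)) : ℝ) ≤ k * Real.logb 3 4 := by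
    rcases Nat.eq_zero_or_pos (stabRank (tpow M (3 * k))) with h | h
    · have : 0 ≤ Real.logb 3 4 := Real.logb_nonneg (by norm_num) (by norm_num)
      rw [h, Nat.cast_zero, Real.logb_zero]
      positivity
    · rw [← Real.logb_pow]
      exact Real.logb_le_logb_of_le (by norm_num) (by exact_mod_cast h) (by exact_mod_cast hrank)
  rw [div_le_div_iff₀ (by positivity) (by norm_num)]
  linarith
end
end
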